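/- G4WK is sound and complete with respect to WK: for every finite multiset Γ and succedent Δ with at most one formula, ⊢_G4WK Γ ⇒ Δ if and only if Γ ⊢_WK δ, where on the right Γ is read as the set of its elements, δ denotes the unique formula of Δ when Δ = {φ}, and δ = ⊥ when Δ = ∅. -/

import Mathlib

/-- Formulas of the modal language: φ ::= p | ⊥ | φ∧φ | φ∨φ | φ→φ | □φ | ◇φ. -/
inductive Form : Type
  | var : ℕ → Form
  | bot : Form
  | and : Form → Form → Form
  | or  : Form → Form → Form
  | imp : Form → Form → Form
  | box : Form → Form
  | dia : Form → Form
  deriving DecidableEq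

/-- Helper for □⁻¹: remove an outer box. -/
def unboxF : Form → Option Form
  | Form.box φ => some φ
  | _ => none

/-- □⁻¹Γ := {φ | □φ ∈ Γ}, as a multiset operation. -/
def boxInv (Γ : Multiset Form) : Multiset Form := Γ.filterMap unboxF

/-- ◇⁻¹Δ for a succedent Δ with at most one formula (modelled by `Option`). -/
def diaInv : Option Form → Option Form
  | some (Form.dia φ) => some φ
  | _ => none

/-- Provability in the sequent calculus G4CK: sequents Γ ⇒ δ with a
multiset antecedent and a single-formula succedent. -/
inductive G4CK : Multiset Form → Form → Prop
  | botL (Γ δ) : G4CK (Form.bot ::ₘ Γ) δ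
  | idP (Γ n) : G4CK (Form.var n ::ₘ Γ) (Form.var n)
  | andL (Γ φ ψ δ) : G4CK (φ ::ₘ ψ ::ₘ Γ) δ → G4CK (Form.and φ ψ ::ₘ Γ) δ
  | andR (Γ φ ψ) : G4CK Γ φ → G4CK Γ ψ → G4CK Γ (Form.and φ ψ)
  | orL (Γ φ ψ δ) : G4CK (φ ::ₘ Γ) δ → G4CK (ψ ::ₘ Γ) δ → G4CK (Form.or φ ψ ::ₘ Γ) δ
  | orR1 (Γ φ ψ) : G4CK Γ φ → G4CK Γ (Form.or φ ψ)
  | orR2 (Γ φ ψ) : G4CK Γ ψ → G4CK Γ (Form.or φ ψ)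
  | impR (Γ φ ψ) : G4CK (φ ::ₘ Γ) ψ → G4CK Γ (Form.imp φ ψ)
  | andImpL (Γ φ ψ χ δ) :
      G4CK (Form.imp φ (Form.imp ψ χ) ::ₘ Γ) δ →
      G4CK (Form.imp (Form.and φ ψ) χ ::ₘ Γ) δ
  | orImpL (Γ φ ψ χ δ) :
      G4CK (Form.imp φ χ ::ₘ Form.imp ψ χ ::ₘ Γ) δ →
      G4CK (Form.imp (Form.or φ ψ) χ ::ₘ Γ) δ
  | pImpL (Γ n φ δ) :
      G4CK (Form.var n ::ₘ φ ::ₘ Γ) δ →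
      G4CK (Form.var n ::ₘ Form.imp (Form.var n) φ ::ₘ Γ) δ
  | impImpL (Γ φ ψ χ δ) :
      G4CK (Form.imp ψ χ ::ₘ Γ) (Form.imp φ ψ) → G4CK (χ ::ₘ Γ) δ →
      G4CK (Form.imp (Form.imp φ ψ) χ ::ₘ Γ) δ
  | boxR (Γ φ) : G4CK (boxInv Γ) φ → G4CK Γ (Form.box φ)
  | boxImpL (Γ φ ψ δ) :
      G4CK (boxInv Γ) φ → G4CK (ψ ::ₘ Γ) δ →
      G4CK (Form.imp (Form.box φ) ψ ::ₘ Γ) δ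
  | diaImpL (Γ γ φ ψ δ) :
      G4CK (γ ::ₘ boxInv Γ) φ → G4CK (ψ ::ₘ Form.dia γ ::ₘ Γ) δ →
      G4CK (Form.imp (Form.dia φ) ψ ::ₘ Form.dia γ ::ₘ Γ) δ
  | diaL (Γ φ ψ) : G4CK (φ ::ₘ boxInv Γ) ψ → G4CK (Form.dia φ ::ₘ Γ) (Form.dia ψ)

/-- Provability in the sequent calculus G4WK: sequents Γ ⇒ Δ with a
multiset antecedent and a succedent with at most one formula (`Option Form`). -/
inductive G4WK : Multiset Form → Option Form → Prop
  | botL (Γ Δ) : G4WK (Form.bot ::ₘ Γ) Δ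
  | idP (Γ n) : G4WK (Form.var n ::ₘ Γ) (some (Form.var n))
  | andL (Γ φ ψ Δ) : G4WK (φ ::ₘ ψ ::ₘ Γ) Δ → G4WK (Form.and φ ψ ::ₘ Γ) Δ
  | andR (Γ φ ψ) : G4WK Γ (some φ) → G4WK Γ (some ψ) → G4WK Γ (some (Form.and φ ψ))
  | orL (Γ φ ψ Δ) : G4WK (φ ::ₘ Γ) Δ → G4WK (ψ ::ₘ Γ) Δ → G4WK (Form.or φ ψ ::ₘ Γ) Δ
  | orR1 (Γ φ ψ) : G4WK Γ (some φ) → G4WK Γ (some (Form.or φ ψ))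
  | orR2 (Γ φ ψ) : G4WK Γ (some ψ) → G4WK Γ (some (Form.or φ ψ))
  | impR (Γ φ ψ) : G4WK (φ ::ₘ Γ) (some ψ) → G4WK Γ (some (Form.imp φ ψ))
  | andImpL (Γ φ ψ χ Δ) :
      G4WK (Form.imp φ (Form.imp ψ χ) ::ₘ Γ) Δ →
      G4WK (Form.imp (Form.and φ ψ) χ ::ₘ Γ) Δ
  | orImpL (Γ φ ψ χ Δ) :
      G4WK (Form.imp φ χ ::ₘ Form.imp ψ χ ::ₘ Γ) Δ →
      G4WK (Form.imp (Form.or φ ψ) χ ::ₘ Γ) Δ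
  | pImpL (Γ n φ Δ) :
      G4WK (Form.var n ::ₘ φ ::ₘ Γ) Δ →
      G4WK (Form.var n ::ₘ Form.imp (Form.var n) φ ::ₘ Γ) Δ
  | impImpL (Γ φ ψ χ Δ) :
      G4WK (Form.imp ψ χ ::ₘ Γ) (some (Form.imp φ ψ)) → G4WK (χ ::ₘ Γ) Δ →
      G4WK (Form.imp (Form.imp φ ψ) χ ::ₘ Γ) Δ
  | boxR (Γ φ) : G4WK (boxInv Γ) (some φ) → G4WK Γ (some (Form.box φ))
  | boxImpL (Γ φ ψ Δ) :
      G4WK (boxInv Γ) (some φ) → G4WK (ψ ::ₘ Γ) Δ →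
      G4WK (Form.imp (Form.box φ) ψ ::ₘ Γ) Δ
  | diaImpL (Γ γ φ ψ Δ) :
      G4WK (γ ::ₘ boxInv Γ) (some φ) → G4WK (ψ ::ₘ Form.dia γ ::ₘ Γ) Δ →
      G4WK (Form.imp (Form.dia φ) ψ ::ₘ Form.dia γ ::ₘ Γ) Δ
  | diaL' (Γ φ Δ) : G4WK (φ ::ₘ boxInv Γ) (diaInv Δ) → G4WK (Form.dia φ ::ₘ Γ) Δ

/-- Axiom schemes of the generalised Hilbert calculus CKH:
intuitionistic axioms A1–A9 together with K_□ and K_◇. -/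
inductive CKAx : Form → Prop
  | a1 (φ ψ : Form) : CKAx (φ.imp (ψ.imp φ))
  | a2 (φ ψ χ : Form) : CKAx ((φ.imp (ψ.imp χ)).imp ((φ.imp ψ).imp (φ.imp χ)))
  | a3 (φ ψ : Form) : CKAx (φ.imp (φ.or ψ))
  | a4 (φ ψ : Form) : CKAx (ψ.imp (φ.or ψ))
  | a5 (φ ψ χ : Form) : CKAx ((φ.imp χ).imp ((ψ.imp χ).imp ((φ.or ψ).imp χ)))
  | a6 (φ ψ : Form) : CKAx ((φ.and ψ).imp φ)
  | a7 (φ ψ : Form) : CKAx ((φ.and ψ).imp ψ)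
  | a8 (φ ψ χ : Form) : CKAx ((φ.imp ψ).imp ((φ.imp χ).imp (φ.imp (ψ.and χ))))
  | a9 (φ : Form) : CKAx (Form.bot.imp φ)
  | kbox (φ ψ : Form) : CKAx ((φ.imp ψ).box.imp (φ.box.imp ψ.box))
  | kdia (φ ψ : Form) : CKAx ((φ.imp ψ).box.imp (φ.dia.imp ψ.dia))

/-- Axiom schemes of WKH: those of CKH together with N : ¬◇⊥. -/
inductive WKAx : Form → Prop
  | ck {φ : Form} : CKAx φ → WKAx φ
  | n : WKAx (Form.bot.dia.imp Form.bot)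

/-- Derivability Γ ⊢ φ in the generalised Hilbert calculus CKH. -/
inductive CKH : Set Form → Form → Prop
  | ax {Γ : Set Form} {φ : Form} : CKAx φ → CKH Γ φ
  | el {Γ : Set Form} {φ : Form} : φ ∈ Γ → CKH Γ φ
  | mp {Γ : Set Form} {φ ψ : Form} : CKH Γ φ → CKH Γ (φ.imp ψ) → CKH Γ ψ
  | nec {Γ : Set Form} {φ : Form} : CKH ∅ φ → CKH Γ φ.box

/-- Derivability Γ ⊢ φ in the generalised Hilbert calculus WKH. -/
inductive WKH : Set Form → Form → Prop
  | ax {Γ : Set Form} {φ : Form} : WKAx φ → WKH Γ φ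
  | el {Γ : Set Form} {φ : Form} : φ ∈ Γ → WKH Γ φ
  | mp {Γ : Set Form} {φ ψ : Form} : WKH Γ φ → WKH Γ (φ.imp ψ) → WKH Γ ψ
  | nec {Γ : Set Form} {φ : Form} : WKH ∅ φ → WKH Γ φ.box

/-- The set of propositional variables occurring in a formula. -/
def vars : Form → Set ℕ
  | .var n => {n}
  | .bot => ∅
  | .and φ ψ => vars φ ∪ vars ψ
  | .or φ ψ => vars φ ∪ vars ψ
  | .imp φ ψ => vars φ ∪ vars ψ
  | .box φ => vars φ
  | .dia φ => vars φ

/-- Variables occurring in a multiset of formulas. -/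
def varsM (Γ : Multiset Form) : Set ℕ := {n | ∃ φ ∈ Γ, n ∈ vars φ}

/-- Variables occurring in a succedent with at most one formula. -/
def varsO : Option Form → Set ℕ
  | none => ∅
  | some φ => vars φ

namespace WKH

theorem imp_refl (Γ : Set Form) (φ : Form) : WKH Γ (φ.imp φ) :=
  mp (ax (.ck (.a1 φ φ))) (mp (ax (.ck (.a1 φ (φ.imp φ)))) (ax (.ck (.a2 φ (φ.imp φ) φ))))

theorem weaken_imp {Γ : Set Form} {φ : Form} (ψ : Form) (h : WKH Γ φ) : WKH Γ (ψ.imp φ) :=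
  mp h (ax (.ck (.a1 φ ψ)))

theorem exfalso {Γ : Set Form} {φ : Form} (h : WKH Γ Form.bot) : WKH Γ φ :=
  mp h (ax (.ck (.a9 φ)))

theorem and_intro {Γ : Set Form} {φ ψ : Form} (h₁ : WKH Γ φ) (h₂ : WKH Γ ψ) :
    WKH Γ (φ.and ψ) :=
  mp h₁ (mp (weaken_imp φ h₂) (mp (imp_refl Γ φ) (ax (.ck (.a8 φ φ ψ)))))

theorem and_left {Γ : Set Form} {φ ψ : Form} (h : WKH Γ (φ.and ψ)) : WKH Γ φ :=
  mp h (ax (.ck (.a6 φ ψ)))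

theorem and_right {Γ : Set Form} {φ ψ : Form} (h : WKH Γ (φ.and ψ)) : WKH Γ ψ :=
  mp h (ax (.ck (.a7 φ ψ)))

theorem or_inl {Γ : Set Form} {φ : Form} (ψ : Form) (h : WKH Γ φ) : WKH Γ (φ.or ψ) :=
  mp h (ax (.ck (.a3 φ ψ)))

theorem or_inr {Γ : Set Form} {ψ : Form} (φ : Form) (h : WKH Γ ψ) : WKH Γ (φ.or ψ) :=
  mp h (ax (.ck (.a4 φ ψ)))

/-- Cut for sets of hypotheses. -/
theorem subst {Γ Γ' : Set Form} {φ : Form} (h : WKH Γ φ) (hΓ : ∀ x ∈ Γ, WKH Γ' x) :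
    WKH Γ' φ := by
  induction h with
  | ax h => exact ax h
  | el h => exact hΓ _ h
  | mp _ _ ih₁ ih₂ => exact mp (ih₁ hΓ) (ih₂ hΓ)
  | nec h => exact nec h

theorem deduction {Γ Γ' : Set Form} {φ ψ : Form} (h : WKH Γ' ψ)
    (hΓ : ∀ x ∈ Γ', x = φ ∨ x ∈ Γ) : WKH Γ (φ.imp ψ) := by
  induction h with
  | ax h => exact weaken_imp φ (ax h)
  | el h =>
    rcases hΓ _ h with rfl | h
    · exact imp_refl _ _
    · exact weaken_imp φ (el h)
  | mp _ _ ih₁ ih₂ => exact mp (ih₁ hΓ) (mp (ih₂ hΓ) (ax (.ck (.a2 _ _ _))))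
  | nec h => exact weaken_imp φ (nec h)

theorem box_of {Γ Γ' : Set Form} {φ : Form} (h : WKH Γ φ) (hΓ : ∀ x ∈ Γ, x.box ∈ Γ') :
    WKH Γ' φ.box := by
  induction h with
  | ax h => exact nec (ax h)
  | el h => exact el (hΓ _ h)
  | mp _ _ ih₁ ih₂ => exact mp (ih₁ hΓ) (mp (ih₂ hΓ) (ax (.ck (.kbox _ _))))
  | nec h => exact nec (nec h)

end WKH

theorem mem_boxInv {Γ : Multiset Form} {φ : Form} : φ ∈ boxInv Γ ↔ φ.box ∈ Γ := by
  unfold boxInv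
  rw [Multiset.mem_filterMap]
  constructor
  · rintro ⟨a, ha, h⟩
    cases a <;> simp_all [unboxF]
  · exact fun h => ⟨_, h, rfl⟩

/-- Hilbert derivability from the elements of a multiset. -/
def Derives (Γ : Multiset Form) (φ : Form) : Prop := WKH {x | x ∈ Γ} φ

namespace Derives

variable {Γ Γ' : Multiset Form} {φ ψ χ : Form}

theorem el (h : φ ∈ Γ) : Derives Γ φ := WKH.el h

theorem mp (h₁ : Derives Γ φ) (h₂ : Derives Γ (φ.imp ψ)) : Derives Γ ψ := WKH.mp h₁ h₂

theorem head (Γ : Multiset Form) (φ : Form) : Derives (φ ::ₘ Γ) φ :=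
  el (Multiset.mem_cons_self _ _)

theorem mono (h : Derives Γ φ) (hΓ : ∀ x ∈ Γ, x ∈ Γ') : Derives Γ' φ :=
  WKH.subst h fun x hx => WKH.el (hΓ x hx)

theorem cons (ψ : Form) (h : Derives Γ φ) : Derives (ψ ::ₘ Γ) φ :=
  h.mono fun _ => Multiset.mem_cons_of_mem

theorem imp_intro (h : Derives (φ ::ₘ Γ) ψ) : Derives Γ (φ.imp ψ) :=
  WKH.deduction h fun _ hx => Multiset.mem_cons.1 hx

theorem imp_elim (h : Derives Γ (φ.imp ψ)) : Derives (φ ::ₘ Γ) ψ :=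
  (head _ _).mp (h.cons φ)

/-- Replace the principal hypothesis by hypotheses deriving it. -/
theorem cut (h : Derives (φ ::ₘ Γ) ψ) (hφ : Derives Γ' φ) (hΓ : ∀ x ∈ Γ, x ∈ Γ') :
    Derives Γ' ψ :=
  WKH.subst h fun x hx => by
    rcases Multiset.mem_cons.1 hx with rfl | hx
    · exact hφ
    · exact WKH.el (hΓ x hx)

theorem or_elim (h₁ : Derives (φ ::ₘ Γ) χ) (h₂ : Derives (ψ ::ₘ Γ) χ) :
    Derives (φ.or ψ ::ₘ Γ) χ :=
  imp_elim (mp (imp_intro h₂) (mp (imp_intro h₁) (WKH.ax (.ck (.a5 φ ψ χ)))))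

theorem box_intro (h : Derives (boxInv Γ) φ) : Derives Γ φ.box :=
  WKH.box_of h fun _ hx => mem_boxInv.1 hx

theorem dia_map (hφ : φ.dia ∈ Γ) (h : Derives (φ ::ₘ boxInv Γ) ψ) : Derives Γ ψ.dia :=
  mp (el hφ) (mp (box_intro (imp_intro h)) (WKH.ax (.ck (.kdia φ ψ))))

theorem bot_of_dia_bot (h : Derives Γ Form.bot.dia) : Derives Γ Form.bot :=
  mp h (WKH.ax .n)

theorem curry (h : Derives Γ ((φ.and ψ).imp χ)) : Derives Γ (φ.imp (ψ.imp χ)) :=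
  imp_intro (imp_intro (mp
    (WKH.and_intro (el (by simp)) (el (by simp))) ((h.cons φ).cons ψ)))

theorem uncurry (h : Derives Γ (φ.imp (ψ.imp χ))) : Derives Γ ((φ.and ψ).imp χ) :=
  imp_intro (mp (WKH.and_right (head _ _)) (mp (WKH.and_left (head _ _)) (h.cons _)))

theorem imp_of_or_imp_left (h : Derives Γ ((φ.or ψ).imp χ)) : Derives Γ (φ.imp χ) :=
  imp_intro (mp (WKH.or_inl ψ (head _ _)) (h.cons _))

theorem imp_of_or_imp_right (h : Derives Γ ((φ.or ψ).imp χ)) : Derives Γ (ψ.imp χ) :=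
  imp_intro (mp (WKH.or_inr φ (head _ _)) (h.cons _))

theorem imp_of_imp_imp (h : Derives Γ ((φ.imp ψ).imp χ)) : Derives Γ (ψ.imp χ) :=
  imp_intro (mp (WKH.weaken_imp φ (head _ _)) (h.cons _))

theorem imp_imp_of (hφ : Derives Γ φ) (h : Derives Γ (ψ.imp χ)) :
    Derives Γ ((φ.imp ψ).imp χ) :=
  imp_intro (mp (mp (hφ.cons _) (head _ _)) (h.cons _))

/-- The left premise of the rule for nested implications is derivable as soon as the
antecedent `φ → ψ` of the principal formula is. -/
theorem imp_imp_premise (h : Derives ((φ.imp ψ).imp χ ::ₘ Γ) (φ.imp ψ)) :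
    Derives (ψ.imp χ ::ₘ Γ) (φ.imp ψ) := by
  refine imp_intro (mp (el (Multiset.mem_cons_self _ _)) (h.cut ?_ ?_))
  · exact imp_imp_of (head _ _) ((head _ _).cons _)
  · intro x hx
    simp [hx]

end Derives

theorem G4WK.sound {Γ : Multiset Form} {Δ : Option Form} (h : G4WK Γ Δ) :
    Derives Γ (Δ.getD Form.bot) := by
  induction h with
  | botL Γ Δ => exact WKH.exfalso (Derives.head _ _)
  | idP Γ n => exact Derives.head _ _
  | andL Γ φ ψ Δ _ ih =>
    have h := (ih.imp_intro.imp_intro).cons (φ.and ψ)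
    exact Derives.mp (WKH.and_left (Derives.head _ _))
      (Derives.mp (WKH.and_right (Derives.head _ _)) h)
  | andR Γ φ ψ _ _ ih₁ ih₂ => exact WKH.and_intro ih₁ ih₂
  | orL Γ φ ψ Δ _ _ ih₁ ih₂ => exact ih₁.or_elim ih₂
  | orR1 Γ φ ψ _ ih => exact WKH.or_inl ψ ih
  | orR2 Γ φ ψ _ ih => exact WKH.or_inr φ ih
  | impR Γ φ ψ _ ih => exact ih.imp_intro
  | andImpL Γ φ ψ χ Δ _ ih =>
    exact ih.cut (Derives.head _ _).curry fun _ => Multiset.mem_cons_of_mem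
  | orImpL Γ φ ψ χ Δ _ ih =>
    have h := (ih.imp_intro.imp_intro).cons ((φ.or ψ).imp χ)
    exact (Derives.head _ _).imp_of_or_imp_left.mp
      ((Derives.head _ _).imp_of_or_imp_right.mp h)
  | pImpL Γ n φ Δ _ ih =>
    rw [Multiset.cons_swap] at ih
    exact ih.cut ((Derives.head _ _).mp ((Derives.head _ _).cons _)) fun x hx => by
      rcases Multiset.mem_cons.1 hx with rfl | hx <;> simp [*]
  | impImpL Γ φ ψ χ Δ _ _ ih₁ ih₂ =>
    refine ih₂.cut (Derives.mp ?_ (Derives.head _ _)) fun _ => Multiset.mem_cons_of_mem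
    exact ih₁.cut (Derives.head _ _).imp_of_imp_imp fun _ => Multiset.mem_cons_of_mem
  | boxR Γ φ _ ih => exact ih.box_intro
  | boxImpL Γ φ ψ Δ _ _ ih₁ ih₂ =>
    exact ih₂.cut ((ih₁.box_intro.cons _).mp (Derives.head _ _)) fun _ =>
      Multiset.mem_cons_of_mem
  | diaImpL Γ γ φ ψ Δ _ _ ih₁ ih₂ =>
    refine ih₂.cut (Derives.mp ?_ (Derives.head _ _)) fun _ => Multiset.mem_cons_of_mem
    refine Derives.dia_map (φ := γ) (by simp) (ih₁.mono fun x hx => ?_)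
    simpa [mem_boxInv] using hx
  | diaL' Γ φ Δ _ ih =>
    have key : ∀ ψ, Derives (φ ::ₘ boxInv Γ) ψ → Derives (φ.dia ::ₘ Γ) ψ.dia := fun ψ h =>
      Derives.dia_map (φ := φ) (by simp) (h.mono fun x hx => by simpa [mem_boxInv] using hx)
    match Δ with
    | some (.dia ψ) => exact key _ ih
    | none | some (.var _) | some .bot | some (.and _ _) | some (.or _ _) | some (.imp _ _)
    | some (.box _) => exact WKH.exfalso (key _ ih).bot_of_dia_bot

/-- An Aczel slash relative to the antecedent `Γ`. -/
def Slash (Γ : Multiset Form) : Form → Prop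
  | .var n => Form.var n ∈ Γ
  | .bot => False
  | .and φ ψ => Slash Γ φ ∧ Slash Γ ψ
  | .or φ ψ => Slash Γ φ ∨ Slash Γ ψ
  | .imp φ ψ => Derives Γ (φ.imp ψ) ∧ (Slash Γ φ → Slash Γ ψ)
  | .box φ => Derives (boxInv Γ) φ
  | .dia φ => ∃ γ, γ.dia ∈ Γ ∧ Derives (γ ::ₘ boxInv Γ) φ

namespace Slash

variable {Γ : Multiset Form}

theorem derives : ∀ {φ : Form}, Slash Γ φ → Derives Γ φ
  | .var _, h => Derives.el h
  | .and _ _, h => WKH.and_intro h.1.derives h.2.derives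
  | .or _ _, h => h.elim (fun h => WKH.or_inl _ h.derives) fun h => WKH.or_inr _ h.derives
  | .imp _ _, h => h.1
  | .box _, h => Derives.box_intro h
  | .dia _, ⟨_, hγ, h⟩ => Derives.dia_map hγ h

theorem imp_intro {φ ψ : Form} (h : Derives Γ (φ.imp ψ)) (hs : Slash Γ φ → Slash Γ ψ) :
    Slash Γ (φ.imp ψ) :=
  ⟨h, hs⟩

theorem of_ax (hc : ∀ γ : Form, γ.dia ∈ Γ → ¬ Derives (γ ::ₘ boxInv Γ) Form.bot)
    {φ : Form} (h : WKAx φ) : Slash Γ φ := by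
  have hax : ∀ {χ}, WKAx χ → Derives Γ χ := WKH.ax
  have hck : ∀ {χ}, CKAx χ → Derives Γ χ := fun h => WKH.ax (.ck h)
  rcases h with h | _
  · cases h with
    | a1 φ ψ =>
      exact imp_intro (hck (.a1 ..)) fun h =>
        imp_intro (h.derives.mp (hck (.a1 ..))) fun _ => h
    | a2 φ ψ χ =>
      refine imp_intro (hck (.a2 ..)) fun h₁ => ?_
      have d := h₁.1.mp (hck (.a2 ..))
      exact imp_intro d fun h₂ =>
        imp_intro (h₂.1.mp d) fun h₃ => (h₁.2 h₃).2 (h₂.2 h₃)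
    | a3 φ ψ => exact imp_intro (hck (.a3 ..)) Or.inl
    | a4 φ ψ => exact imp_intro (hck (.a4 ..)) Or.inr
    | a5 φ ψ χ =>
      refine imp_intro (hck (.a5 ..)) fun h₁ => ?_
      have d := h₁.1.mp (hck (.a5 _ ψ _))
      exact imp_intro d fun h₂ => imp_intro (h₂.1.mp d) fun h => h.elim h₁.2 h₂.2
    | a6 φ ψ => exact imp_intro (hck (.a6 ..)) And.left
    | a7 φ ψ => exact imp_intro (hck (.a7 ..)) And.right
    | a8 φ ψ χ =>
      refine imp_intro (hck (.a8 ..)) fun h₁ => ?_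
      have d := h₁.1.mp (hck (.a8 _ _ χ))
      exact imp_intro d fun h₂ => imp_intro (h₂.1.mp d) fun h => ⟨h₁.2 h, h₂.2 h⟩
    | a9 φ => exact imp_intro (hck (.a9 ..)) False.elim
    | kbox φ ψ =>
      refine imp_intro (hck (.kbox ..)) fun h₁ => ?_
      exact imp_intro (h₁.derives.mp (hck (.kbox ..))) fun h₂ => Derives.mp h₂ h₁
    | kdia φ ψ =>
      refine imp_intro (hck (.kdia ..)) fun h₁ => ?_
      refine imp_intro (h₁.derives.mp (hck (.kdia ..))) ?_
      rintro ⟨γ, hγ, h₂⟩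
      exact ⟨γ, hγ, h₂.mp (Derives.cons γ h₁)⟩
  · exact imp_intro (hax .n) fun ⟨γ, hγ, h⟩ => hc γ hγ h

theorem of_derives (hc : ∀ γ : Form, γ.dia ∈ Γ → ¬ Derives (γ ::ₘ boxInv Γ) Form.bot)
    (hΓ : ∀ x ∈ Γ, Slash Γ x) {φ : Form} (h : Derives Γ φ) : Slash Γ φ := by
  unfold Derives at h
  generalize hS : {x | x ∈ Γ} = S at h
  induction h with
  | ax h => exact of_ax hc h
  | el h =>
    subst hS
    exact hΓ _ h
  | mp _ _ ih₁ ih₂ => exact (ih₂ hS).2 (ih₁ hS)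
  | nec h => exact WKH.subst h fun _ hx => hx.elim

end Slash

/-- The weight of a formula. -/
def Form.weight : Form → ℕ
  | .var _ => 0
  | .bot => 0
  | .and φ ψ => φ.weight + ψ.weight + 2
  | .or φ ψ => φ.weight + ψ.weight + 1
  | .imp φ ψ => φ.weight + ψ.weight + 1
  | .box φ => φ.weight + 1
  | .dia φ => φ.weight + 1

/-- The contribution of a formula to the size of a sequent. -/
def Form.cost (φ : Form) : ℕ := 3 ^ φ.weight

theorem Form.cost_lt {φ ψ : Form} (h : φ.weight < ψ.weight) : φ.cost < ψ.cost :=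
  Nat.pow_lt_pow_right (by norm_num) h

theorem Form.cost_add_cost_lt {φ ψ χ : Form} (h₁ : φ.weight < χ.weight)
    (h₂ : ψ.weight < χ.weight) : φ.cost + ψ.cost < χ.cost := by
  have h : ∀ {θ : Form}, θ.weight < χ.weight → 3 * θ.cost ≤ χ.cost := fun {θ} h => by
    have := Nat.pow_le_pow_right (n := 3) (by norm_num) (Nat.succ_le_of_lt h)
    rwa [Nat.pow_succ, Nat.mul_comm] at this
  have h₁ := h h₁
  have h₂ := h h₂
  have : 0 < χ.cost := Nat.pow_pos (by norm_num)
  omega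

/-- The total cost of an antecedent. -/
def antecedentCost (Γ : Multiset Form) : ℕ := (Γ.map Form.cost).sum

/-- The cost of a succedent. -/
def succedentCost (Δ : Option Form) : ℕ := Δ.elim 0 Form.cost

@[simp] theorem antecedentCost_cons (φ : Form) (Γ : Multiset Form) :
    antecedentCost (φ ::ₘ Γ) = φ.cost + antecedentCost Γ := by
  simp [antecedentCost]

theorem antecedentCost_boxInv_le (Γ : Multiset Form) :
    antecedentCost (boxInv Γ) ≤ antecedentCost Γ := by
  induction Γ using Multiset.induction_on with
  | empty => simp [boxInv]
  | cons φ Γ ih =>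
    cases φ with
    | box φ =>
      have h : boxInv (φ.box ::ₘ Γ) = φ ::ₘ boxInv Γ :=
        Multiset.filterMap_cons_some unboxF φ.box Γ rfl
      have := Form.cost_lt (φ := φ) (ψ := φ.box) (by simp [Form.weight])
      rw [h, antecedentCost_cons, antecedentCost_cons]
      omega
    | _ =>
      rw [boxInv, Multiset.filterMap_cons_none _ _ rfl, antecedentCost_cons]
      exact ih.trans (Nat.le_add_left _ _)

theorem succedentCost_diaInv_le (Δ : Option Form) :
    succedentCost (diaInv Δ) ≤ succedentCost Δ := by
  match Δ with
  | some (.dia φ) => exact (Form.cost_lt (by simp [Form.weight])).le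
  | none | some (.var _) | some .bot | some (.and _ _) | some (.or _ _) | some (.imp _ _)
  | some (.box _) => exact Nat.zero_le _

theorem boxInv_cons_of_unboxF_eq_none {φ : Form} (h : unboxF φ = none) (Γ : Multiset Form) :
    boxInv (φ ::ₘ Γ) = boxInv Γ :=
  Multiset.filterMap_cons_none φ Γ h

/-- All sequents cheaper than `Γ ⇒ Δ` satisfy completeness. -/
def CompleteBelow (Γ : Multiset Form) (Δ : Option Form) : Prop :=
  ∀ Γ' Δ', antecedentCost Γ' + succedentCost Δ' < antecedentCost Γ + succedentCost Δ →
    Derives Γ' (Δ'.getD Form.bot) → G4WK Γ' Δ'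

namespace CompleteBelow

variable {Γ : Multiset Form} {Δ : Option Form}

theorem diaL' (ih : CompleteBelow Γ Δ) {γ : Form} (hγ : γ.dia ∈ Γ)
    (h : Derives (γ ::ₘ boxInv Γ) ((diaInv Δ).getD Form.bot)) : G4WK Γ Δ := by
  obtain ⟨Γ, rfl⟩ := Multiset.exists_cons_of_mem hγ
  rw [boxInv_cons_of_unboxF_eq_none rfl] at h
  refine .diaL' _ _ _ (ih _ _ ?_ h)
  have := antecedentCost_boxInv_le Γ
  have := succedentCost_diaInv_le Δ
  have := Form.cost_lt (φ := γ) (ψ := γ.dia) (by simp [Form.weight])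
  simp only [antecedentCost_cons]
  omega

/-- An implication in the antecedent of a derivable sequent is slashed, unless the sequent is
provable by a rule applied to it. -/
theorem slash_imp (ih : CompleteBelow Γ Δ) (h : Derives Γ (Δ.getD Form.bot))
    (hn : ¬ G4WK Γ Δ) {α χ : Form} (hx : α.imp χ ∈ Γ) : Slash Γ (α.imp χ) := by
  refine Slash.imp_intro (Derives.el hx) fun hs => (hn ?_).elim
  have hcost : ∀ {Γ' Γ : Multiset Form} {φ ψ : Form}, φ.cost < ψ.cost →
      antecedentCost Γ' ≤ antecedentCost Γ →
      antecedentCost Γ' + succedentCost (some φ) <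
        antecedentCost (ψ ::ₘ Γ) + succedentCost Δ := fun hlt hle => by
    simp only [antecedentCost_cons, succedentCost, Option.elim_some]
    omega
  have hχ : χ.cost < (α.imp χ).cost := Form.cost_lt (by simp only [Form.weight]; omega)
  obtain ⟨Γ, rfl⟩ := Multiset.exists_cons_of_mem hx
  have hright : G4WK (χ ::ₘ Γ) Δ :=
    ih _ _ (by simp only [antecedentCost_cons]; omega)
      (h.cut (WKH.weaken_imp α (Derives.head _ _)) fun _ => Multiset.mem_cons_of_mem)
  cases α with
  | var n =>
    have hs : Form.var n ∈ Γ := by simpa [Slash] using hs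
    obtain ⟨Γ, rfl⟩ := Multiset.exists_cons_of_mem hs
    rw [Multiset.cons_swap] at hright ⊢
    exact .pImpL _ _ _ _ hright
  | bot => exact hs.elim
  | and φ ψ =>
    refine .andImpL _ _ _ _ _ (ih _ _ ?_ (h.cut (Derives.head _ _).uncurry
      fun _ => Multiset.mem_cons_of_mem))
    have := Form.cost_lt (φ := φ.imp (ψ.imp χ)) (ψ := (φ.and ψ).imp χ)
      (by simp only [Form.weight]; omega)
    simp only [antecedentCost_cons]
    omega
  | or φ ψ =>
    refine .orImpL _ _ _ _ _ (ih _ _ ?_ (h.cut ?_ ?_))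
    · have := Form.cost_add_cost_lt (φ := φ.imp χ) (ψ := ψ.imp χ) (χ := (φ.or ψ).imp χ)
        (by simp only [Form.weight]; omega) (by simp only [Form.weight]; omega)
      simp only [antecedentCost_cons]
      omega
    · exact Derives.mp ((Derives.head _ _).cons _)
        (Derives.mp (Derives.head _ _) (WKH.ax (.ck (.a5 φ ψ χ))))
    · intro x hx
      simp [hx]
  | imp φ ψ =>
    refine .impImpL _ _ _ _ _ (ih _ _ ?_ hs.1.imp_imp_premise) hright
    have := Form.cost_add_cost_lt (φ := ψ.imp χ) (ψ := φ.imp ψ) (χ := (φ.imp ψ).imp χ)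
      (by simp only [Form.weight]; omega) (by simp only [Form.weight]; omega)
    simp only [antecedentCost_cons, succedentCost, Option.elim_some]
    omega
  | box φ =>
    have hs : Derives (boxInv Γ) φ := by
      rw [← boxInv_cons_of_unboxF_eq_none (φ := φ.box.imp χ) rfl]
      exact hs
    exact .boxImpL _ _ _ _ (ih _ _ (hcost
      (Form.cost_lt (by simp only [Form.weight]; omega)) (antecedentCost_boxInv_le Γ)) hs) hright
  | dia φ =>
    obtain ⟨γ, hγ, hs⟩ := hs
    have hγ : γ.dia ∈ Γ := by simpa using hγ
    obtain ⟨Γ, rfl⟩ := Multiset.exists_cons_of_mem hγ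
    rw [boxInv_cons_of_unboxF_eq_none rfl, boxInv_cons_of_unboxF_eq_none rfl] at hs
    refine .diaImpL _ _ _ _ _ (ih _ _ (hcost
      (Form.cost_lt (by simp only [Form.weight]; omega)) ?_) hs) hright
    have := antecedentCost_boxInv_le Γ
    have := Form.cost_lt (φ := γ) (ψ := γ.dia) (by simp [Form.weight])
    simp only [antecedentCost_cons]
    omega

/-- Every formula in the antecedent of a derivable sequent is slashed, unless the sequent is
provable by a rule applied to it. -/
theorem slash_mem (ih : CompleteBelow Γ Δ) (h : Derives Γ (Δ.getD Form.bot))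
    (hn : ¬ G4WK Γ Δ) {x : Form} (hx : x ∈ Γ) : Slash Γ x := by
  cases x with
  | var n => exact hx
  | bot =>
    obtain ⟨Γ, rfl⟩ := Multiset.exists_cons_of_mem hx
    exact (hn (.botL _ _)).elim
  | and φ ψ =>
    obtain ⟨Γ, rfl⟩ := Multiset.exists_cons_of_mem hx
    refine (hn (.andL _ _ _ _ (ih _ _ ?_ (h.cut ?_ ?_)))).elim
    · have := Form.cost_add_cost_lt (φ := φ) (ψ := ψ) (χ := φ.and ψ)
        (by simp only [Form.weight]; omega) (by simp only [Form.weight]; omega)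
      simp only [antecedentCost_cons]
      omega
    · exact WKH.and_intro (Derives.head _ _) ((Derives.head _ _).cons _)
    · intro x hx
      simp [hx]
  | or φ ψ =>
    obtain ⟨Γ, rfl⟩ := Multiset.exists_cons_of_mem hx
    have hφ := Form.cost_lt (φ := φ) (ψ := φ.or ψ) (by simp only [Form.weight]; omega)
    have hψ := Form.cost_lt (φ := ψ) (ψ := φ.or ψ) (by simp only [Form.weight]; omega)
    refine (hn (.orL _ _ _ _ (ih _ _ ?_ (h.cut ?_ ?_)) (ih _ _ ?_ (h.cut ?_ ?_)))).elim
    · simpa using hφ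
    · exact WKH.or_inl _ (Derives.head _ _)
    · exact fun _ => Multiset.mem_cons_of_mem
    · simpa using hψ
    · exact WKH.or_inr _ (Derives.head _ _)
    · exact fun _ => Multiset.mem_cons_of_mem
  | imp α χ => exact ih.slash_imp h hn hx
  | box φ => exact Derives.el (mem_boxInv.2 hx)
  | dia φ => exact ⟨φ, hx, Derives.head _ _⟩

/-- A sequent whose succedent is slashed is provable. -/
theorem of_slash (ih : CompleteBelow Γ Δ) (hs : Slash Γ (Δ.getD Form.bot)) : G4WK Γ Δ := by
  have step : ∀ {Γ' : Multiset Form} {φ ψ : Form}, Δ = some ψ → φ.weight < ψ.weight →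
      antecedentCost Γ' ≤ antecedentCost Γ → Derives Γ' φ → G4WK Γ' (some φ) :=
    fun hΔ hlt hle hd => ih _ _ (by
      have := Form.cost_lt hlt
      simp only [hΔ, succedentCost, Option.elim_some]
      omega) hd
  match Δ with
  | none | some .bot => exact hs.elim
  | some (.var n) =>
    obtain ⟨Γ, rfl⟩ := Multiset.exists_cons_of_mem (show Form.var n ∈ Γ from hs)
    exact .idP _ _
  | some (.and φ ψ) =>
    exact .andR _ _ _ (step rfl (by simp only [Form.weight]; omega) le_rfl hs.1.derives)
      (step rfl (by simp only [Form.weight]; omega) le_rfl hs.2.derives)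
  | some (.or φ ψ) =>
    rcases hs with hs | hs
    · exact .orR1 _ _ _ (step rfl (by simp only [Form.weight]; omega) le_rfl hs.derives)
    · exact .orR2 _ _ _ (step rfl (by simp only [Form.weight]; omega) le_rfl hs.derives)
  | some (.imp φ ψ) =>
    refine .impR _ _ _ (ih _ _ ?_ hs.1.imp_elim)
    have := Form.cost_add_cost_lt (φ := φ) (ψ := ψ) (χ := φ.imp ψ)
      (by simp only [Form.weight]; omega) (by simp only [Form.weight]; omega)
    simp only [antecedentCost_cons, succedentCost, Option.elim_some]
    omega
  | some (.box φ) =>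
    exact .boxR _ _ (step rfl (by simp only [Form.weight]; omega)
      (antecedentCost_boxInv_le Γ) hs)
  | some (.dia φ) =>
    obtain ⟨γ, hγ, hs⟩ := hs
    exact ih.diaL' hγ hs

end CompleteBelow

theorem G4WK.complete (Γ : Multiset Form) (Δ : Option Form)
    (h : Derives Γ (Δ.getD Form.bot)) : G4WK Γ Δ := by
  have ih : CompleteBelow Γ Δ := fun Γ' Δ' _ h' => G4WK.complete Γ' Δ' h'
  by_contra hn
  have hc : ∀ γ : Form, γ.dia ∈ Γ → ¬ Derives (γ ::ₘ boxInv Γ) Form.bot := fun γ hγ hd =>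
    hn (ih.diaL' hγ (WKH.exfalso hd))
  exact hn (ih.of_slash (Slash.of_derives hc (fun _ => ih.slash_mem h hn) h))
termination_by antecedentCost Γ + succedentCost Δ

/-- G4WK is sound and complete with respect to WK: Γ ⇒ Δ is provable in
G4WK iff Γ (read as a set) derives δ in the Hilbert calculus WKH, where
δ is the unique formula of Δ if Δ is a singleton and ⊥ if Δ is empty. -/
theorem G4WK_sound_complete :
    ∀ (Γ : Multiset Form) (Δ : Option Form),
      G4WK Γ Δ ↔ WKH {φ | φ ∈ Γ} (Δ.getD Form.bot) := by
  exact fun Γ Δ => ⟨G4WK.sound, G4WK.complete Γ Δ⟩
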